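/- arXiv:1804.01588 — 2 statements merged into one kernel-verified Lean document; each statement's English description precedes it below -/
import Mathlib

section
/- For every natural number d there exists a constant C > 0 (depending only on d) with the following property. Let (X, dist) be a finite metric space with n = |X| points and correlation dimension at most d. Then for every ε ∈ (0, 1) and every subset T ⊆ X with |T| ≥ 2 there exists an edge set S on T such that d_S(x, y) ≤ (1 + ε) · dist(x, y) for all x, y ∈ T and w(S) ≤ C · ε^{-(d/2 + 3)} · log(2 + ε⁻¹) · √n · mstw(T). -/
open scoped ENNReal BigOperators

universe u

/-- The distance function lifted to unordered pairs. -/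
noncomputable def sym2Dist {X : Type u} [MetricSpace X] : Sym2 X → ℝ :=
  Sym2.lift ⟨fun x y => dist x y, fun _ _ => dist_comm _ _⟩

/-- The weight of an edge set: the sum of the distances of its pairs. -/
noncomputable def edgeWeight {X : Type u} [MetricSpace X] (E : Finset (Sym2 X)) : ℝ :=
  ∑ e ∈ E, sym2Dist e

/-- `E` is an edge set on `T`: a finite set of unordered pairs of distinct points of `T`. -/
def IsEdgeSetOn {X : Type u} (T : Finset X) (E : Finset (Sym2 X)) : Prop :=
  ∀ e ∈ E, ¬ e.IsDiag ∧ ∀ x ∈ e, x ∈ T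

/-- The length of the path starting at `p` and visiting the points of the list in order. -/
noncomputable def pathLength {X : Type u} [MetricSpace X] : X → List X → ℝ
  | _, [] => 0
  | p, x :: xs => dist p x + pathLength x xs

/-- `p :: l` is a path from `p` to `q` all of whose consecutive pairs are edges of `E`. -/
def IsPathIn {X : Type u} (E : Finset (Sym2 X)) (p q : X) (l : List X) : Prop :=
  List.Chain (fun a b => s(a, b) ∈ E) p l ∧ (p :: l).getLast (List.cons_ne_nil p l) = q

/-- The path-distance in the edge set `E`: the infimum in `[0, ∞]` of lengths of paths
in `E` from `p` to `q`. -/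
noncomputable def pathDist {X : Type u} [MetricSpace X] (E : Finset (Sym2 X)) (p q : X) :
    ℝ≥0∞ :=
  ⨅ (l : List X) (_ : IsPathIn E p q l), ENNReal.ofReal (pathLength p l)

/-- The minimum weight of an edge set on `T` connecting all points of `T` (MST weight). -/
noncomputable def mstw {X : Type u} [MetricSpace X] (T : Finset X) : ℝ :=
  sInf {w : ℝ | ∃ E : Finset (Sym2 X), IsEdgeSetOn T E ∧
    (∀ x ∈ T, ∀ y ∈ T, pathDist E x y < ⊤) ∧ w = edgeWeight E}

/-- X has correlation dimension at most d. -/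
def HasCorrDimLE (X : Type u) [MetricSpace X] [Fintype X] (d : ℕ) : Prop :=
  ∀ ζ : ℝ, 0 < ζ → ∀ N : Finset X,
    (∀ y : X, ∃ p ∈ N, dist p y ≤ ζ) →
    (∀ p ∈ N, ∀ q ∈ N, p ≠ q → ζ < dist p q) →
    ∀ r : ℝ, 0 < r →
      ∑ x ∈ N, (N.filter fun y => dist x y ≤ 2 * r).card ≤
        2 ^ d * ∑ x ∈ N, (N.filter fun y => dist x y ≤ r).card


section Helpers

lemma sym2Dist_mk {X : Type u} [MetricSpace X] (x y : X) : sym2Dist s(x, y) = dist x y := rfl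

lemma sym2Dist_nonneg {X : Type u} [MetricSpace X] (e : Sym2 X) : 0 ≤ sym2Dist e := by
  induction e using Sym2.ind with
  | _ x y => exact dist_nonneg

lemma isPathIn_nil {X : Type u} (E : Finset (Sym2 X)) (p : X) : IsPathIn E p p [] := by
  constructor
  · simp [List.Chain]
  · simp

lemma isPathIn_cons {X : Type u} (E : Finset (Sym2 X)) (p q x : X) (l : List X) :
    IsPathIn E p q (x :: l) ↔ s(p, x) ∈ E ∧ IsPathIn E x q l := by
  unfold IsPathIn List.Chain
  rw [List.isChain_cons_cons, List.getLast_cons (List.cons_ne_nil x l), and_assoc]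

lemma path_append {X : Type u} [MetricSpace X] (E : Finset (Sym2 X)) (q r : X) (l' : List X)
    (h' : IsPathIn E q r l') : ∀ (l : List X) (p : X), IsPathIn E p q l →
      IsPathIn E p r (l ++ l') ∧ pathLength p (l ++ l') = pathLength p l + pathLength q l' := by
  intro l
  induction l with
  | nil =>
    intro p h
    have : p = q := by simpa [IsPathIn] using h.2
    subst this
    simpa [pathLength] using h'
  | cons x xs ih =>
    intro p h
    rw [isPathIn_cons] at h
    obtain ⟨h1, h2⟩ := ih x h.2
    refine ⟨?_, ?_⟩
    · rw [List.cons_append, isPathIn_cons]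
      exact ⟨h.1, h1⟩
    · rw [List.cons_append, pathLength, pathLength, h2]
      ring

/-- Variation of a function along an edge. -/
noncomputable def edgeVar {X : Type u} (f : X → ℝ) : Sym2 X → ℝ :=
  Sym2.lift ⟨fun x y => |f x - f y|, fun _ _ => abs_sub_comm _ _⟩

lemma edgeVar_nonneg {X : Type u} (f : X → ℝ) (e : Sym2 X) : 0 ≤ edgeVar f e := by
  induction e using Sym2.ind with
  | _ x y => exact abs_nonneg _

lemma walk_var {X : Type u} (G : SimpleGraph X) (f : X → ℝ) {u v : X} (w : G.Walk u v) :
    |f u - f v| ≤ (w.edges.map (edgeVar f)).sum := by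
  induction w with
  | nil => simp
  | @cons a b c h p ih =>
    rw [SimpleGraph.Walk.edges_cons, List.map_cons, List.sum_cons]
    have h1 : edgeVar f s(a, b) = |f a - f b| := rfl
    rw [h1]
    have := abs_sub_le (f a) (f b) (f c)
    linarith

lemma reach_of_path {X : Type u} (E : Finset (Sym2 X)) (q : X) : ∀ (l : List X) (p : X),
    IsPathIn E p q l → (SimpleGraph.fromEdgeSet (E : Set (Sym2 X))).Reachable p q := by
  intro l
  induction l with
  | nil =>
    intro p h
    have : p = q := by simpa [IsPathIn] using h.2
    subst this
    exact SimpleGraph.Reachable.refl _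
  | cons x xs ih =>
    intro p h
    rw [isPathIn_cons] at h
    have h2 := ih x h.2
    by_cases hpx : p = x
    · subst hpx; exact h2
    · refine SimpleGraph.Reachable.trans (SimpleGraph.Adj.reachable ?_) h2
      rw [SimpleGraph.fromEdgeSet_adj]
      exact ⟨by simpa using h.1, hpx⟩

lemma var_le {X : Type u} [MetricSpace X] (E : Finset (Sym2 X)) (f : X → ℝ) (p q : X)
    (h : pathDist E p q < ⊤) : |f p - f q| ≤ ∑ e ∈ E, edgeVar f e := by
  classical
  unfold pathDist at h
  simp only [iInf_lt_iff] at h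
  obtain ⟨l, hl, -⟩ := h
  obtain ⟨w, hw⟩ := (reach_of_path E q l p hl).exists_isPath
  refine (walk_var _ f w).trans ?_
  rw [← List.sum_toFinset _ hw.isTrail.edges_nodup]
  apply Finset.sum_le_sum_of_subset_of_nonneg
  · intro e he
    have := w.edges_subset_edgeSet (List.mem_toFinset.1 he)
    rw [SimpleGraph.edgeSet_fromEdgeSet] at this
    simpa using this.1
  · intro e _ _
    exact edgeVar_nonneg f e

lemma dist_le_weight {X : Type u} [MetricSpace X] (E : Finset (Sym2 X)) (p q : X)
    (h : pathDist E p q < ⊤) : dist p q ≤ edgeWeight E := by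
  have h1 := var_le E (fun x => dist p x) p q h
  simp only [dist_self, zero_sub, abs_neg, abs_of_nonneg dist_nonneg] at h1
  refine h1.trans (Finset.sum_le_sum ?_)
  intro e _
  induction e using Sym2.ind with
  | _ x y =>
    change |dist p x - dist p y| ≤ dist x y
    rw [dist_comm p x, dist_comm p y]
    exact abs_dist_sub_le x y p

lemma bump_sum {X : Type u} [MetricSpace X] (N : Finset X) (s : ℝ)
    (hN : ∀ p ∈ N, ∀ q ∈ N, p ≠ q → s < dist p q) (x y : X) :
    ∑ p ∈ N, |max 0 (s / 2 - dist p x) - max 0 (s / 2 - dist p y)| ≤ dist x y := by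
  classical
  have hfar : ∀ z p, p ∈ N → dist p z < s / 2 → ∀ q ∈ N, q ≠ p →
      max 0 (s / 2 - dist q z) = 0 := by
    intro z p hp hpz q hq hqp
    apply max_eq_left
    have h1 := hN q hq p hp hqp
    have h2 := dist_triangle q z p
    rw [dist_comm z p] at h2
    linarith
  have hone : ∀ p, |max 0 (s / 2 - dist p x) - max 0 (s / 2 - dist p y)| ≤ dist x y := by
    intro p
    have h := abs_max_sub_max_le_abs (s / 2 - dist p x) (s / 2 - dist p y) 0
    rw [max_comm 0, max_comm 0]
    refine h.trans ?_
    have : s / 2 - dist p x - (s / 2 - dist p y) = dist y p - dist x p := by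
      rw [dist_comm p x, dist_comm p y]; ring
    rw [this, dist_comm x y]
    exact abs_dist_sub_le y x p
  have hsingle : ∀ p ∈ N, (∀ q ∈ N, q ≠ p →
      |max 0 (s / 2 - dist q x) - max 0 (s / 2 - dist q y)| = 0) →
      ∑ p ∈ N, |max 0 (s / 2 - dist p x) - max 0 (s / 2 - dist p y)| ≤ dist x y := by
    intro p hp h
    rw [Finset.sum_eq_single_of_mem p hp h]
    exact hone p
  have hnone : ∀ z, (¬ ∃ p ∈ N, dist p z < s / 2) → ∀ q ∈ N, max 0 (s / 2 - dist q z) = 0 := by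
    intro z hz q hq
    push Not at hz
    apply max_eq_left
    linarith [hz q hq]
  by_cases hx : ∃ p ∈ N, dist p x < s / 2
  · obtain ⟨p, hp, hpx⟩ := hx
    by_cases hy : ∃ q ∈ N, dist q y < s / 2
    · obtain ⟨q, hq, hqy⟩ := hy
      by_cases hpq : p = q
      · subst hpq
        apply hsingle p hp
        intro q hq hqp
        rw [hfar x p hp hpx q hq hqp, hfar y p hp hqy q hq hqp]; simp
      · rw [Finset.sum_eq_add_of_mem p q hp hq hpq]
        · rw [hfar y q hq hqy p hp hpq, hfar x p hp hpx q hq (Ne.symm hpq),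
            max_eq_right (by linarith), max_eq_right (by linarith), sub_zero, zero_sub, abs_neg,
            abs_of_nonneg (by linarith), abs_of_nonneg (by linarith)]
          have h1 := hN p hp q hq hpq
          have h2 := dist_triangle4 p x y q
          rw [dist_comm y q] at h2
          linarith
        · intro c hc hcc
          rw [hfar x p hp hpx c hc hcc.1, hfar y q hq hqy c hc hcc.2]; simp
    · apply hsingle p hp
      intro q hq hqp
      rw [hfar x p hp hpx q hq hqp, hnone y hy q hq]; simp
  · by_cases hy : ∃ q ∈ N, dist q y < s / 2
    · obtain ⟨p, hp, hpy⟩ := hy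
      apply hsingle p hp
      intro q hq hqp
      rw [hfar y p hp hpy q hq hqp, hnone x hx q hq]; simp
    · rw [Finset.sum_eq_zero]
      · exact dist_nonneg
      · intro q hq
        rw [hnone y hy q hq, hnone x hx q hq]; simp

lemma packing {X : Type u} [MetricSpace X] (E : Finset (Sym2 X)) (N : Finset X) (s : ℝ)
    (hs : 0 < s) (hN : ∀ p ∈ N, ∀ q ∈ N, p ≠ q → s < dist p q)
    (hE : ∀ p ∈ N, ∀ q ∈ N, pathDist E p q < ⊤) (hc : 1 < N.card) :
    N.card * (s / 2) ≤ edgeWeight E := by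
  have h1 : ∀ p ∈ N, s / 2 ≤ ∑ e ∈ E, edgeVar (fun x => max 0 (s / 2 - dist p x)) e := by
    intro p hp
    obtain ⟨q, hq, hqp⟩ := Finset.exists_mem_ne hc p
    have h := var_le E (fun x => max 0 (s / 2 - dist p x)) p q (hE p hp q hq)
    have h2 := hN p hp q hq (Ne.symm hqp)
    rw [max_eq_left (by linarith : s / 2 - dist p q ≤ 0), dist_self,
      max_eq_right (by linarith), sub_zero, sub_zero, abs_of_nonneg (by linarith)] at h
    exact h
  calc (N.card : ℝ) * (s / 2) = ∑ p ∈ N, s / 2 := by simp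
    _ ≤ ∑ p ∈ N, ∑ e ∈ E, edgeVar (fun x => max 0 (s / 2 - dist p x)) e := Finset.sum_le_sum h1
    _ = ∑ e ∈ E, ∑ p ∈ N, edgeVar (fun x => max 0 (s / 2 - dist p x)) e := Finset.sum_comm
    _ ≤ ∑ e ∈ E, sym2Dist e := by
      apply Finset.sum_le_sum
      intro e _
      induction e using Sym2.ind with
      | _ x y => exact bump_sum N s hN x y

lemma mst_set_nonempty {X : Type u} [MetricSpace X] (T : Finset X) :
    {w : ℝ | ∃ E : Finset (Sym2 X), IsEdgeSetOn T E ∧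
      (∀ x ∈ T, ∀ y ∈ T, pathDist E x y < ⊤) ∧ w = edgeWeight E}.Nonempty := by
  classical
  refine ⟨_, T.sym2.filter (fun e => ¬ e.IsDiag), ?_, ?_, rfl⟩
  · intro e he
    rw [Finset.mem_filter] at he
    exact ⟨he.2, fun x hx => Finset.mem_sym2_iff.1 he.1 x hx⟩
  · intro x hx y hy
    unfold pathDist
    simp only [iInf_lt_iff]
    by_cases h : x = y
    · subst h
      exact ⟨[], isPathIn_nil _ _, ENNReal.ofReal_lt_top⟩
    · refine ⟨[y], ?_, ENNReal.ofReal_lt_top⟩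
      rw [isPathIn_cons]
      refine ⟨?_, isPathIn_nil _ _⟩
      simp [hx, hy, h]

lemma dist_le_mstw {X : Type u} [MetricSpace X] (T : Finset X) (x y : X) (hx : x ∈ T)
    (hy : y ∈ T) : dist x y ≤ mstw T := by
  apply le_csInf (mst_set_nonempty T)
  rintro w ⟨E, -, hE, rfl⟩
  exact dist_le_weight E x y (hE x hx y hy)

lemma packing_mstw {X : Type u} [MetricSpace X] (T N : Finset X) (hNT : N ⊆ T) (s : ℝ)
    (hs : 0 < s) (hN : ∀ p ∈ N, ∀ q ∈ N, p ≠ q → s < dist p q) (hc : 1 < N.card) :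
    N.card * (s / 2) ≤ mstw T := by
  apply le_csInf (mst_set_nonempty T)
  rintro w ⟨E, -, hE, rfl⟩
  exact packing E N s hs hN (fun p hp q hq => hE p (hNT hp) q (hNT hq)) hc

lemma exists_net {X : Type u} [MetricSpace X] (A B : Finset X) (hAB : A ⊆ B) (s : ℝ)
    (hs : 0 < s) (hA : ∀ p ∈ A, ∀ q ∈ A, p ≠ q → s < dist p q) :
    ∃ N : Finset X, A ⊆ N ∧ N ⊆ B ∧ (∀ p ∈ N, ∀ q ∈ N, p ≠ q → s < dist p q) ∧
      ∀ y ∈ B, ∃ p ∈ N, dist p y ≤ s := by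
  classical
  let F := B.powerset.filter (fun N => ∀ p ∈ N, ∀ q ∈ N, p ≠ q → s < dist p q)
  have hAF : A ∈ F := by
    simp only [F, Finset.mem_filter, Finset.mem_powerset]
    exact ⟨hAB, hA⟩
  obtain ⟨N, hAN, hN⟩ := Finset.exists_le_maximal F hAF
  have hNF : N ⊆ B ∧ (∀ p ∈ N, ∀ q ∈ N, p ≠ q → s < dist p q) := by
    have := hN.prop
    simpa only [F, Finset.mem_filter, Finset.mem_powerset] using this
  refine ⟨N, hAN, hNF.1, hNF.2, ?_⟩
  intro y hy
  by_contra hcon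
  push Not at hcon
  have hins : insert y N ∈ F := by
    simp only [F, Finset.mem_filter, Finset.mem_powerset]
    refine ⟨Finset.insert_subset hy hNF.1, ?_⟩
    intro p hp q hq hpq
    rw [Finset.mem_insert] at hp hq
    rcases hp with rfl | hp <;> rcases hq with rfl | hq
    · exact absurd rfl hpq
    · rw [dist_comm]; exact hcon q hq
    · exact hcon p hp
    · exact hNF.2 p hp q hq hpq
  have hyN : y ∈ N := hN.le_of_ge hins (Finset.subset_insert y N) (Finset.mem_insert_self y N)
  have := hcon y hyN
  rw [dist_self] at this
  linarith

/-- Ordered pairs of distinct points of `N` at distance at most `ρ`. -/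
noncomputable def closePairs {X : Type u} [MetricSpace X] (N : Finset X) (ρ : ℝ) :
    Finset (X × X) :=
  open Classical in (N ×ˢ N).filter (fun p => p.1 ≠ p.2 ∧ dist p.1 p.2 ≤ ρ)

lemma closePairs_card_packing {X : Type u} [MetricSpace X] (T N : Finset X) (hNT : N ⊆ T) (s : ℝ)
    (hs : 0 < s) (hN : ∀ p ∈ N, ∀ q ∈ N, p ≠ q → s < dist p q) (ρ : ℝ) :
    ((closePairs N ρ).card : ℝ) ≤ (2 * mstw T / s) ^ 2 := by
  classical
  by_cases hc : 1 < N.card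
  · have h := packing_mstw T N hNT s hs hN hc
    have h1 : (N.card : ℝ) ≤ 2 * mstw T / s := by
      rw [le_div_iff₀ hs]; linarith
    have h2 : (closePairs N ρ).card ≤ N.card * N.card := by
      rw [← Finset.card_product]
      exact Finset.card_filter_le _ _
    calc ((closePairs N ρ).card : ℝ) ≤ (N.card : ℝ) * N.card := by exact_mod_cast h2
      _ = (N.card : ℝ) ^ 2 := by ring
      _ ≤ _ := by gcongr
  · have : closePairs N ρ = ∅ := by
      rw [Finset.eq_empty_iff_forall_notMem]
      intro p hp
      simp only [closePairs, Finset.mem_filter, Finset.mem_product] at hp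
      exact hp.2.1 (Finset.card_le_one.1 (not_lt.1 hc) _ hp.1.1 _ hp.1.2)
    rw [this]
    simp only [Finset.card_empty, Nat.cast_zero]
    positivity

lemma corr_iter {X : Type u} [MetricSpace X] [Fintype X] (d : ℕ) (hX : HasCorrDimLE X d)
    (s : ℝ) (hs : 0 < s) (N : Finset X) (hN : ∀ p ∈ N, ∀ q ∈ N, p ≠ q → s < dist p q)
    (hcov : ∀ y : X, ∃ p ∈ N, dist p y ≤ s) (j : ℕ) :
    ∑ x ∈ N, (N.filter fun y => dist x y ≤ 2 ^ j * s).card ≤ (2 ^ j) ^ d * Fintype.card X := by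
  classical
  induction j with
  | zero =>
    simp only [pow_zero, one_mul, one_pow]
    refine le_trans ?_ (Finset.card_le_univ N)
    rw [Finset.card_eq_sum_ones]
    apply Finset.sum_le_sum
    intro x hx
    rw [Finset.card_le_one]
    have key : ∀ a ∈ N.filter (fun y => dist x y ≤ s), a = x := by
      intro a ha
      rw [Finset.mem_filter] at ha
      by_contra hne
      have := hN x hx a ha.1 (Ne.symm hne)
      linarith [ha.2]
    intro a ha b hb
    rw [key a ha, key b hb]
  | succ j ih =>
    have h := hX s hs N hcov hN (2 ^ j * s) (by positivity)
    have e : ∀ x : ℝ, 2 ^ (j + 1) * x = 2 * (2 ^ j * x) := by intro x; ring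
    simp only [e]
    calc _ ≤ _ := h
      _ ≤ 2 ^ d * ((2 ^ j) ^ d * Fintype.card X) := Nat.mul_le_mul_left _ ih
      _ = _ := by rw [← mul_assoc, ← mul_pow]; ring

lemma closePairs_card_corr {X : Type u} [MetricSpace X] [Fintype X] (d : ℕ)
    (hX : HasCorrDimLE X d) (N : Finset X) (s : ℝ)
    (hs : 0 < s) (hN : ∀ p ∈ N, ∀ q ∈ N, p ≠ q → s < dist p q) (a : ℝ) (ha : 1 ≤ a) :
    ((closePairs N (a * s)).card : ℝ) ≤ (2 * a) ^ d * Fintype.card X := by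
  classical
  obtain ⟨M, hNM, -, hM, hcov⟩ := exists_net N Finset.univ (Finset.subset_univ N) s hs hN
  obtain ⟨j, hj1, hj2⟩ := exists_nat_pow_near ha (by norm_num : (1 : ℝ) < 2)
  have h := corr_iter d hX s hs M hM (fun y => hcov y (Finset.mem_univ y)) (j + 1)
  have h1 : (closePairs N (a * s)).card ≤
      ∑ x ∈ M, (M.filter fun y => dist x y ≤ 2 ^ (j + 1) * s).card := by
    rw [← Finset.card_sigma]
    apply Finset.card_le_card_of_injOn (fun p => (⟨p.1, p.2⟩ : Σ _ : X, X))
    · intro p hp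
      simp only [closePairs, Finset.coe_filter, Finset.mem_product, Set.mem_ofPred_eq] at hp
      simp only [Finset.coe_sigma, Set.mem_sigma_iff, Finset.mem_coe, Finset.mem_filter]
      refine ⟨hNM hp.1.1, hNM hp.1.2, hp.2.2.trans ?_⟩
      gcongr
    · rintro ⟨p1, p2⟩ _ ⟨q1, q2⟩ _ hpq
      simpa using hpq
  have h2 : ((closePairs N (a * s)).card : ℝ) ≤ (2 ^ (j + 1)) ^ d * Fintype.card X := by
    exact_mod_cast h1.trans h
  refine h2.trans ?_
  have : (2 : ℝ) ^ (j + 1) ≤ 2 * a := by rw [pow_succ]; linarith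
  gcongr

/-- Edges obtained from close pairs. -/
noncomputable def closeEdges {X : Type u} [MetricSpace X] (N : Finset X) (ρ : ℝ) :
    Finset (Sym2 X) :=
  open Classical in (closePairs N ρ).image (fun p => s(p.1, p.2))

lemma closeEdges_weight {X : Type u} [MetricSpace X] (N : Finset X) (ρ : ℝ) (hρ : 0 ≤ ρ) :
    edgeWeight (closeEdges N ρ) ≤ (closePairs N ρ).card * ρ := by
  classical
  calc edgeWeight (closeEdges N ρ) ≤ (closeEdges N ρ).card • ρ := by
        apply Finset.sum_le_card_nsmul
        intro e he
        simp only [closeEdges, Finset.mem_image] at he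
        obtain ⟨p, hp, rfl⟩ := he
        simp only [closePairs, Finset.mem_filter] at hp
        exact hp.2.2
    _ = ((closeEdges N ρ).card : ℝ) * ρ := by simp
    _ ≤ _ := by
        gcongr
        exact Finset.card_image_le

lemma edgeWeight_biUnion {X : Type u} [MetricSpace X] [DecidableEq (Sym2 X)] {ι : Type*}
    (F : Finset ι) (S : ι → Finset (Sym2 X)) :
    edgeWeight (F.biUnion S) ≤ ∑ k ∈ F, edgeWeight (S k) := by
  classical
  induction F using Finset.induction_on with
  | empty => simp [edgeWeight]
  | insert a F ha ih =>
    rw [Finset.biUnion_insert, Finset.sum_insert ha]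
    have h := Finset.sum_union_inter (s₁ := S a) (s₂ := F.biUnion S) (f := sym2Dist)
    have h2 : 0 ≤ ∑ e ∈ S a ∩ F.biUnion S, sym2Dist e :=
      Finset.sum_nonneg (fun e _ => sym2Dist_nonneg e)
    unfold edgeWeight at *
    linarith

lemma stretch {X : Type u} [MetricSpace X] (T : Finset X) (S : Finset (Sym2 X)) (ε : ℝ)
    (hε : 0 < ε) (hε1 : ε < 1)
    (h : ∀ x ∈ T, ∀ y ∈ T, x ≠ y → ∃ r : ℝ, 0 < r ∧ r < dist x y ∧ ∃ x' ∈ T, ∃ y' ∈ T,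
      dist x x' ≤ ε / 6 * r ∧ dist y' y ≤ ε / 6 * r ∧ (x' = y' ∨ s(x', y') ∈ S)) :
    ∀ n : ℕ, ∀ x ∈ T, ∀ y ∈ T, ((T ×ˢ T).filter fun p => dist p.1 p.2 < dist x y).card ≤ n →
      ∃ l, IsPathIn S x y l ∧ pathLength x l ≤ (1 + ε) * dist x y := by
  intro n
  induction n using Nat.strong_induction_on with
  | _ n ih =>
    intro x hx y hy hn
    by_cases hxy : x = y
    · subst hxy
      exact ⟨[], isPathIn_nil _ _, by simp [pathLength]⟩
    obtain ⟨r, hr, hrd, x', hx', y', hy', h1, h2, h3⟩ := h x hx y hy hxy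
    have hlt : ∀ a ∈ T, ∀ b ∈ T, dist a b < dist x y →
        ((T ×ˢ T).filter fun p => dist p.1 p.2 < dist a b).card < n := by
      intro a ha b hb hab
      refine lt_of_lt_of_le (Finset.card_lt_card ?_) hn
      rw [Finset.ssubset_iff_of_subset]
      · refine ⟨(a, b), ?_, ?_⟩
        · simp [ha, hb, hab]
        · simp
      · intro p hp
        rw [Finset.mem_filter] at hp ⊢
        exact ⟨hp.1, hp.2.trans hab⟩
    have hsm : ε / 6 * r < dist x y := by nlinarith
    obtain ⟨l1, hl1, hw1⟩ := ih _ (hlt x hx x' hx' (by linarith)) x hx x' hx' le_rfl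
    obtain ⟨l2, hl2, hw2⟩ := ih _ (hlt y' hy' y hy (by linarith)) y' hy' y hy le_rfl
    have hmid : ∃ l, IsPathIn S x' y' l ∧ pathLength x' l = dist x' y' := by
      rcases h3 with h3 | h3
      · subst h3
        exact ⟨[], isPathIn_nil _ _, by simp [pathLength]⟩
      · refine ⟨[y'], ?_, by simp [pathLength]⟩
        rw [isPathIn_cons]
        exact ⟨h3, isPathIn_nil _ _⟩
    obtain ⟨l, hl, hw⟩ := hmid
    obtain ⟨ha, hwa⟩ := path_append S y' y l2 hl2 l x' hl
    obtain ⟨hb, hwb⟩ := path_append S x' y _ ha l1 x hl1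
    refine ⟨_, hb, ?_⟩
    rw [hwb, hwa, hw]
    have ht := dist_triangle4 x' x y y'
    rw [dist_comm x' x, dist_comm y y'] at ht
    have e1 : (1 + ε) * dist x x' ≤ 2 * (ε / 6 * r) := by
      have := @dist_nonneg _ _ x x'
      nlinarith
    have e2 : (1 + ε) * dist y' y ≤ 2 * (ε / 6 * r) := by
      have := @dist_nonneg _ _ y' y
      nlinarith
    have e3 : ε * r ≤ ε * dist x y := by gcongr
    linarith

lemma summable_geo : Summable (fun k : ℤ => ((1 : ℝ) / 2) ^ k.natAbs) := by
  apply Summable.of_nat_of_neg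
  · simpa using summable_geometric_two
  · simpa using summable_geometric_two

end Helpers

lemma scale_bound (m Q δ P : ℝ) (hm : 0 < m) (hQ : 0 < Q) (hδ : 0 < δ) (k : ℤ)
    (h1 : P ≤ (2 * m / (δ * (m / (δ * Q) * 2 ^ k))) ^ 2) (h2 : P ≤ Q ^ 2) :
    P * (4 * (m / (δ * Q) * 2 ^ k)) ≤ 16 * m * Q / δ * (1 / 2) ^ k.natAbs := by
  have hpos : (0 : ℝ) < 2 ^ k := by positivity
  rcases Int.natAbs_eq k with hk | hk
  · generalize k.natAbs = j at *
    subst hk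
    rw [zpow_natCast] at *
    calc P * (4 * (m / (δ * Q) * 2 ^ j))
        ≤ (2 * m / (δ * (m / (δ * Q) * 2 ^ j))) ^ 2 * (4 * (m / (δ * Q) * 2 ^ j)) := by gcongr
      _ = _ := by
        rw [one_div, inv_pow]
        field_simp
        norm_num
  · generalize k.natAbs = j at *
    subst hk
    have e : (2 : ℝ) ^ (-(j : ℤ)) = (1 / 2) ^ j := by
      rw [zpow_neg, zpow_natCast, one_div, inv_pow]
    rw [e] at *
    calc P * (4 * (m / (δ * Q) * (1 / 2) ^ j))
        ≤ Q ^ 2 * (4 * (m / (δ * Q) * (1 / 2) ^ j)) := by gcongr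
      _ = 4 * (m * Q / δ * (1 / 2) ^ j) := by field_simp
      _ ≤ 16 * (m * Q / δ * (1 / 2) ^ j) := by gcongr; norm_num
      _ = _ := by ring

lemma eps_bound (d : ℕ) (ε : ℝ) (hε : 0 < ε) (hε1 : ε < 1) :
    Real.sqrt ((48 / ε) ^ d) / ε ≤
      Real.sqrt (48 ^ d) * (ε ^ (-((d : ℝ) / 2 + 3)) * Real.log (2 + ε⁻¹)) := by
  have h1 : Real.sqrt ((48 / ε) ^ d) = Real.sqrt (48 ^ d) * ε ^ (-((d : ℝ) / 2)) := by
    rw [div_pow, Real.sqrt_div (by positivity), Real.rpow_neg hε.le, div_eq_mul_inv]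
    congr 2
    rw [Real.sqrt_eq_rpow, ← Real.rpow_natCast, ← Real.rpow_mul hε.le]
    congr 1
    ring
  have h2 : ε ^ (-((d : ℝ) / 2)) / ε ≤ ε ^ (-((d : ℝ) / 2 + 3)) := by
    rw [← Real.rpow_sub_one hε.ne']
    apply Real.rpow_le_rpow_of_exponent_ge hε hε1.le
    linarith
  have h3 : 1 ≤ Real.log (2 + ε⁻¹) := by
    rw [Real.le_log_iff_exp_le (by positivity)]
    have : 1 < ε⁻¹ := (one_lt_inv₀ hε).2 hε1
    have := Real.exp_one_lt_d9
    linarith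
  have h4 : (0 : ℝ) ≤ ε ^ (-((d : ℝ) / 2 + 3)) := by positivity
  rw [h1, mul_div_assoc]
  gcongr
  nlinarith

/-- Theorem 6: subset spanners with lightness Õ(ε^{-(d/2+3)} √n) for metrics of
correlation dimension at most d. -/
theorem corr_dim_light_subset_spanner (d : ℕ) :
    ∃ C : ℝ, 0 < C ∧
      ∀ (X : Type u) [MetricSpace X] [Fintype X], HasCorrDimLE X d →
        ∀ ε : ℝ, 0 < ε → ε < 1 →
          ∀ T : Finset X, 2 ≤ T.card →
            ∃ S : Finset (Sym2 X), IsEdgeSetOn T S ∧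
              (∀ x ∈ T, ∀ y ∈ T, pathDist S x y ≤ ENNReal.ofReal ((1 + ε) * dist x y)) ∧
              edgeWeight S ≤ C * ε ^ (-((d : ℝ) / 2 + 3)) * Real.log (2 + ε⁻¹) *
                Real.sqrt (Fintype.card X) * mstw T := by
  classical
  set C0 : ℝ := ∑' k : ℤ, ((1 : ℝ) / 2) ^ k.natAbs with hC0
  have hC0n : 0 ≤ C0 := tsum_nonneg (fun k => by positivity)
  refine ⟨96 * (C0 + 1) * Real.sqrt (48 ^ d), by positivity, ?_⟩
  intro X _ _ hX ε hε hε1 T hT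
  obtain ⟨x0, hx0, y0, hy0, hxy0⟩ := Finset.one_lt_card.1 hT
  set m := mstw T with hmdef
  have hm : 0 < m := lt_of_lt_of_le (dist_pos.2 hxy0) (dist_le_mstw T x0 y0 hx0 hy0)
  have hn : 0 < Fintype.card X := Fintype.card_pos_iff.2 ⟨x0⟩
  set Q := Real.sqrt ((48 / ε) ^ d * Fintype.card X) with hQdef
  have hn' : (0 : ℝ) < Fintype.card X := by exact_mod_cast hn
  have hQ : 0 < Q := by positivity
  have hQ2 : Q ^ 2 = (48 / ε) ^ d * Fintype.card X := Real.sq_sqrt (by positivity)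
  set δ := ε / 6 with hδdef
  have hδ : 0 < δ := by positivity
  set r : ℤ → ℝ := fun k => m / (δ * Q) * 2 ^ k with hrdef
  have hr : ∀ k, 0 < r k := fun k => by positivity
  have hnet : ∀ k : ℤ, ∃ N : Finset X, N ⊆ T ∧
      (∀ p ∈ N, ∀ q ∈ N, p ≠ q → δ * r k < dist p q) ∧ ∀ y ∈ T, ∃ p ∈ N, dist p y ≤ δ * r k := by
    intro k
    obtain ⟨N, -, h1, h2, h3⟩ := exists_net ∅ T (Finset.empty_subset T) (δ * r k)
      (mul_pos hδ (hr k)) (by simp)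
    exact ⟨N, h1, h2, h3⟩
  choose N hNT hNsep hNcov using hnet
  have hscale : ∀ p : X × X, ∃ k : ℤ, p.1 ≠ p.2 →
      r k < dist p.1 p.2 ∧ dist p.1 p.2 ≤ 2 * r k := by
    intro p
    by_cases hp : p.1 = p.2
    · exact ⟨0, fun h => absurd hp h⟩
    · have hpos : 0 < dist p.1 p.2 / (m / (δ * Q)) := div_pos (dist_pos.2 hp) (by positivity)
      obtain ⟨k, hk1, hk2⟩ := exists_mem_Ioc_zpow hpos (by norm_num : (1 : ℝ) < 2)
      refine ⟨k, fun _ => ⟨?_, ?_⟩⟩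
      · rw [lt_div_iff₀ (by positivity)] at hk1
        simp only [hrdef]
        linarith
      · rw [div_le_iff₀ (by positivity), zpow_add_one₀ (by norm_num)] at hk2
        simp only [hrdef]
        linarith
  choose κ hκ using hscale
  set F : Finset ℤ := (T ×ˢ T).image κ with hF
  refine ⟨F.biUnion (fun k => closeEdges (N k) (4 * r k)), ?_, ?_, ?_⟩
  · intro e he
    rw [Finset.mem_biUnion] at he
    obtain ⟨k, -, he⟩ := he
    simp only [closeEdges, closePairs, Finset.mem_image, Finset.mem_filter,
      Finset.mem_product] at he
    obtain ⟨p, hp, rfl⟩ := he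
    refine ⟨by simpa using hp.2.1, ?_⟩
    intro x hx
    rw [Sym2.mem_iff] at hx
    rcases hx with rfl | rfl
    · exact hNT k hp.1.1
    · exact hNT k hp.1.2
  · have key := stretch T (F.biUnion (fun k => closeEdges (N k) (4 * r k))) ε hε hε1 (by
      intro x hx y hy hxy
      obtain ⟨h1, h2⟩ := hκ (x, y) hxy
      set k := κ (x, y) with hk
      obtain ⟨x', hx', hxx⟩ := hNcov k x hx
      obtain ⟨y', hy', hyy⟩ := hNcov k y hy
      refine ⟨r k, hr k, h1, x', hNT k hx', y', hNT k hy', by rw [dist_comm]; exact hxx, hyy, ?_⟩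
      by_cases he : x' = y'
      · exact Or.inl he
      · right
        rw [Finset.mem_biUnion]
        refine ⟨k, Finset.mem_image.2 ⟨(x, y), Finset.mem_product.2 ⟨hx, hy⟩, rfl⟩, ?_⟩
        simp only [closeEdges, closePairs, Finset.mem_image, Finset.mem_filter,
          Finset.mem_product]
        refine ⟨(x', y'), ⟨⟨hx', hy'⟩, he, ?_⟩, rfl⟩
        have h4 := dist_triangle4 x' x y y'
        rw [dist_comm y y'] at h4
        have h5 : δ * r k ≤ 1 * r k := by
          have := (hr k).le
          gcongr
          rw [hδdef]; linarith
        simp only at h2 ⊢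
        linarith)
    intro x hx y hy
    obtain ⟨l, hl, hw⟩ := key _ x hx y hy le_rfl
    exact (iInf₂_le l hl).trans (ENNReal.ofReal_le_ofReal hw)
  · have hW : ∀ k, edgeWeight (closeEdges (N k) (4 * r k)) ≤
        16 * m * Q / δ * (1 / 2) ^ k.natAbs := by
      intro k
      have hs : 0 < δ * r k := mul_pos hδ (hr k)
      refine (closeEdges_weight _ _ (by linarith [hr k])).trans ?_
      refine scale_bound m Q δ _ hm hQ hδ k
        (closePairs_card_packing T (N k) (hNT k) _ hs (hNsep k) _) ?_
      have h := closePairs_card_corr d hX (N k) _ hs (hNsep k) (24 / ε)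
        (by rw [le_div_iff₀ hε]; linarith)
      have e1 : 24 / ε * (δ * r k) = 4 * r k := by
        rw [hδdef]; field_simp; ring
      have e2 : 2 * (24 / ε) = 48 / ε := by ring
      rw [e1, e2] at h
      rw [hQ2]
      exact h
    have hQs : Q = Real.sqrt ((48 / ε) ^ d) * Real.sqrt (Fintype.card X) :=
      Real.sqrt_mul (by positivity) _
    calc edgeWeight (F.biUnion (fun k => closeEdges (N k) (4 * r k)))
        ≤ ∑ k ∈ F, edgeWeight (closeEdges (N k) (4 * r k)) := edgeWeight_biUnion F _
      _ ≤ ∑ k ∈ F, 16 * m * Q / δ * (1 / 2) ^ k.natAbs := Finset.sum_le_sum (fun k _ => hW k)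
      _ = 16 * m * Q / δ * ∑ k ∈ F, ((1 : ℝ) / 2) ^ k.natAbs := by rw [Finset.mul_sum]
      _ ≤ 16 * m * Q / δ * (C0 + 1) := by
        have : ∑ k ∈ F, ((1 : ℝ) / 2) ^ k.natAbs ≤ C0 :=
          summable_geo.sum_le_tsum F (fun k _ => by positivity)
        gcongr
        linarith
      _ = 96 * (C0 + 1) * (Real.sqrt ((48 / ε) ^ d) / ε) * Real.sqrt (Fintype.card X) * m := by
        rw [hQs, hδdef]; field_simp; norm_num
      _ ≤ 96 * (C0 + 1) * (Real.sqrt (48 ^ d) * (ε ^ (-((d : ℝ) / 2 + 3)) *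
          Real.log (2 + ε⁻¹))) * Real.sqrt (Fintype.card X) * m := by
        gcongr
        exact eps_bound d ε hε hε1
      _ = _ := by ring
end

section
/- For every natural number d there exists a constant C > 0 (depending only on d) with the following property. Let (X, dist) be a metric space such that for every x ∈ X and every r > 0 the closed ball of radius 2r around x can be covered by at most 2^d closed balls of radius r (X has doubling dimension at most d). Then for every ε ∈ (0, 1), every real ℓ > 0, and every nonempty finite subset T ⊆ X, there exists an edge set E on T with |E| ≤ C · ε^{-d} · |T| such that for all distinct x, y ∈ T with ℓ/8 ≤ dist(x, y) ≤ ℓ one has d_E(x, y) ≤ (1 + ε) · dist(x, y). -/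
open scoped ENNReal BigOperators

universe u

theorem net_exists {X : Type u} [MetricSpace X] (δ : ℝ) (hδ : 0 < δ) (T : Finset X) :
    ∃ N : Finset X, N ⊆ T ∧ (∀ x ∈ N, ∀ y ∈ N, dist x y ≤ δ → x = y) ∧
      ∀ x ∈ T, ∃ y ∈ N, dist x y ≤ δ := by
  classical
  induction T using Finset.induction_on with
  | empty => exact ⟨∅, by simp, by simp, by simp⟩
  | insert a T ha ih =>
    obtain ⟨N, hNT, hsep, hcov⟩ := ih
    by_cases h : ∃ y ∈ N, dist a y ≤ δ
    · refine ⟨N, hNT.trans (Finset.subset_insert _ _), hsep, ?_⟩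
      intro x hx
      rcases Finset.mem_insert.1 hx with rfl | hx
      · exact h
      · exact hcov x hx
    · refine ⟨insert a N, Finset.insert_subset_insert _ hNT, ?_, ?_⟩
      · intro x hx y hy hxy
        rcases Finset.mem_insert.1 hx with rfl | hx' <;>
          rcases Finset.mem_insert.1 hy with rfl | hy'
        · rfl
        · exact absurd ⟨y, hy', hxy⟩ h
        · exact absurd ⟨x, hx', by rwa [dist_comm]⟩ h
        · exact hsep x hx' y hy' hxy
      · intro x hx
        rcases Finset.mem_insert.1 hx with rfl | hx
        · exact ⟨x, Finset.mem_insert_self _ _, by simpa using hδ.le⟩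
        · obtain ⟨y, hy, hxy⟩ := hcov x hx
          exact ⟨y, Finset.mem_insert_of_mem hy, hxy⟩

theorem cover_pow {X : Type u} [MetricSpace X] (d : ℕ)
    (h : ∀ (x : X) (r : ℝ), 0 < r →
          ∃ F : Finset X, F.card ≤ 2 ^ d ∧
            Metric.closedBall x (2 * r) ⊆ ⋃ y ∈ (F : Set X), Metric.closedBall y r)
    (k : ℕ) : ∀ (x : X) (r : ℝ), 0 < r →
      ∃ F : Finset X, F.card ≤ (2 ^ d) ^ k ∧
        ∀ z, dist z x ≤ 2 ^ k * r → ∃ y ∈ F, dist z y ≤ r := by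
  classical
  induction k with
  | zero => exact fun x r _ => ⟨{x}, by simp, by simp⟩
  | succ k ih =>
    intro x r hr
    obtain ⟨F, hF, hcov⟩ := ih x (2 * r) (by positivity)
    choose G hG hGc using fun y => h y r hr
    refine ⟨F.biUnion G, ?_, ?_⟩
    · calc (F.biUnion G).card ≤ F.card * 2 ^ d := Finset.card_biUnion_le_card_mul _ _ _ (fun y _ => hG y)
        _ ≤ (2 ^ d) ^ k * 2 ^ d := Nat.mul_le_mul_right _ hF
        _ = (2 ^ d) ^ (k + 1) := (pow_succ _ _).symm
    · intro z hz
      obtain ⟨y, hy, hzy⟩ := hcov z (by rw [pow_succ] at hz; linarith)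
      have := hGc y (Metric.mem_closedBall.2 hzy)
      simp only [Set.mem_iUnion, Metric.mem_closedBall] at this
      obtain ⟨w, hw, hzw⟩ := this
      exact ⟨w, Finset.mem_biUnion.2 ⟨y, hy, hw⟩, hzw⟩

theorem pathDist_refl_le {X : Type u} [MetricSpace X] (E : Finset (Sym2 X)) (p : X) :
    pathDist E p p = 0 := by
  refine le_antisymm ?_ bot_le
  refine (iInf₂_le (f := fun (l : List X) (_ : IsPathIn E p p l) =>
    ENNReal.ofReal (pathLength p l)) [] ⟨List.IsChain.singleton _, rfl⟩).trans ?_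
  simp [pathLength]

theorem pathDist_step {X : Type u} [MetricSpace X] (E : Finset (Sym2 X)) (p x q : X)
    (h : p = x ∨ s(p, x) ∈ E) :
    pathDist E p q ≤ ENNReal.ofReal (dist p x) + pathDist E x q := by
  rcases h with rfl | h
  · simp
  · conv_rhs => unfold pathDist
    rw [ENNReal.add_iInf]
    refine le_iInf fun l => ?_
    by_cases hl : IsPathIn E x q l
    · simp only [hl, iInf_pos]
      refine (iInf₂_le (f := fun (l : List X) (_ : IsPathIn E p q l) =>
        ENNReal.ofReal (pathLength p l)) (x :: l) ⟨?_, ?_⟩).trans ?_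
      · exact List.IsChain.cons_cons h hl.1
      · simpa using hl.2
      · simp only [pathLength]
        exact ENNReal.ofReal_add_le
    · simp [hl]

/-- Lemma 14: metrics of doubling dimension at most d have a (1+ε)-spanner oracle with
strong sparsity O(ε^{-d}). -/
theorem doubling_sparse_spanner_oracle (d : ℕ) :
    ∃ C : ℝ, 0 < C ∧
      ∀ (X : Type u) [MetricSpace X],
        (∀ (x : X) (r : ℝ), 0 < r →
          ∃ F : Finset X, F.card ≤ 2 ^ d ∧
            Metric.closedBall x (2 * r) ⊆ ⋃ y ∈ (F : Set X), Metric.closedBall y r) →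
        ∀ ε : ℝ, 0 < ε → ε < 1 → ∀ ℓ : ℝ, 0 < ℓ →
          ∀ T : Finset X, T.Nonempty →
            ∃ E : Finset (Sym2 X), IsEdgeSetOn T E ∧
              (E.card : ℝ) ≤ C * ε⁻¹ ^ d * T.card ∧
              ∀ x ∈ T, ∀ y ∈ T, x ≠ y → ℓ / 8 ≤ dist x y → dist x y ≤ ℓ →
                pathDist E x y ≤ ENNReal.ofReal ((1 + ε) * dist x y) := by
  classical
  refine ⟨256 ^ d + 1, by positivity, ?_⟩
  intro X _ hX ε hε hε1 ℓ hℓ T hT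
  obtain ⟨N, hNT, hsep, hcov⟩ := net_exists (ε * ℓ / 32) (by positivity) T
  have hcov' : ∀ x, ∃ y, x ∈ T → y ∈ N ∧ dist x y ≤ ε * ℓ / 32 := by
    intro x
    by_cases hx : x ∈ T
    · obtain ⟨y, hy, h⟩ := hcov x hx
      exact ⟨y, fun _ => ⟨hy, h⟩⟩
    · exact ⟨x, fun h => absurd h hx⟩
  choose f hf using hcov'
  obtain ⟨n, hn1, hn2⟩ := exists_nat_pow_near (x := 128 * ε⁻¹) (y := (2 : ℝ))
    (by have := (one_le_inv₀ hε).2 hε1.le; linarith) (by norm_num)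
  have hdeg : ∀ u, ((N.filter (fun v => dist v u ≤ 2 * ℓ)).card : ℝ) ≤ 256 ^ d * ε⁻¹ ^ d := by
    intro u
    have h2 : (0 : ℝ) < 2 ^ (n + 1) := by positivity
    obtain ⟨F, hF, hFc⟩ := cover_pow d hX (n + 1) u (2 * ℓ / 2 ^ (n + 1)) (by positivity)
    have hr : 2 * ℓ / 2 ^ (n + 1) ≤ ε * ℓ / 64 := by
      rw [div_le_iff₀ h2]
      have : 128 ≤ ε * 2 ^ (n + 1) := by
        have := mul_le_mul_of_nonneg_left hn2.le hε.le
        have h3 : ε * (128 * ε⁻¹) = 128 := by field_simp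
        linarith
      nlinarith
    have hmul : 2 ^ (n + 1) * (2 * ℓ / 2 ^ (n + 1)) = 2 * ℓ := by field_simp
    rw [hmul] at hFc
    have hFc' : ∀ z, ∃ y, dist z u ≤ 2 * ℓ → y ∈ F ∧ dist z y ≤ 2 * ℓ / 2 ^ (n + 1) := by
      intro z
      by_cases hz : dist z u ≤ 2 * ℓ
      · obtain ⟨y, hy, h⟩ := hFc z hz
        exact ⟨y, fun _ => ⟨hy, h⟩⟩
      · exact ⟨z, fun h => absurd h hz⟩
    choose g hg using hFc'
    have hcard : (N.filter (fun v => dist v u ≤ 2 * ℓ)).card ≤ F.card := by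
      refine Finset.card_le_card_of_injOn g ?_ ?_
      · intro v hv
        exact (hg v (Finset.mem_filter.1 hv).2).1
      · intro v hv w hw hvw
        have hv' := Finset.mem_filter.1 hv
        have hw' := Finset.mem_filter.1 hw
        have h1 := (hg v hv'.2).2
        have h3 := (hg w hw'.2).2
        rw [← hvw] at h3
        refine hsep v hv'.1 w hw'.1 ?_
        have := dist_triangle_right v w (g v)
        linarith
    calc ((N.filter (fun v => dist v u ≤ 2 * ℓ)).card : ℝ) ≤ (((2 ^ d) ^ (n + 1) : ℕ) : ℝ) := by
          exact_mod_cast hcard.trans hF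
      _ = (2 ^ (n + 1)) ^ d := by push_cast; rw [← pow_mul, ← pow_mul, mul_comm]
      _ ≤ (256 * ε⁻¹) ^ d := by
          refine pow_le_pow_left₀ h2.le ?_ _
          rw [pow_succ]; linarith
      _ = 256 ^ d * ε⁻¹ ^ d := mul_pow _ _ _
  set A : Finset (Sym2 X) := T.image (fun x => s(x, f x)) with hA
  set B : Finset (Sym2 X) := N.biUnion (fun u =>
    (N.filter (fun v => dist v u ≤ 2 * ℓ)).image (fun v => s(u, v))) with hB
  have hmem : ∀ a b, s(a, b) ∈ A ∪ B → a = b ∨ s(a, b) ∈ (A ∪ B).filter (fun e => ¬ e.IsDiag) := by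
    intro a b h
    by_cases hab : a = b
    · exact Or.inl hab
    · exact Or.inr (Finset.mem_filter.2 ⟨h, by simpa using hab⟩)
  refine ⟨(A ∪ B).filter (fun e => ¬ e.IsDiag), ?_, ?_, ?_⟩
  · intro e he
    obtain ⟨he, hd⟩ := Finset.mem_filter.1 he
    refine ⟨hd, ?_⟩
    rcases Finset.mem_union.1 he with he | he
    · obtain ⟨x, hx, rfl⟩ := Finset.mem_image.1 he
      intro y hy
      rcases Sym2.mem_iff.1 hy with rfl | rfl
      · exact hx
      · exact hNT (hf x hx).1
    · obtain ⟨u, hu, he⟩ := Finset.mem_biUnion.1 he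
      obtain ⟨v, hv, rfl⟩ := Finset.mem_image.1 he
      intro y hy
      rcases Sym2.mem_iff.1 hy with rfl | rfl
      · exact hNT hu
      · exact hNT (Finset.mem_filter.1 hv).1
  · have h1 : ((((A ∪ B).filter (fun e => ¬ e.IsDiag)).card : ℕ) : ℝ) ≤ A.card + B.card := by
      exact_mod_cast (Finset.card_filter_le _ _).trans (Finset.card_union_le _ _)
    have h2 : (A.card : ℝ) ≤ T.card := by exact_mod_cast Finset.card_image_le
    have h3 : (B.card : ℝ) ≤ N.card * (256 ^ d * ε⁻¹ ^ d) := by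
      calc (B.card : ℝ) ≤ ∑ u ∈ N, ((N.filter (fun v => dist v u ≤ 2 * ℓ)).card : ℝ) := by
            exact_mod_cast Finset.card_biUnion_le.trans
              (Finset.sum_le_sum fun u _ => Finset.card_image_le)
        _ ≤ ∑ u ∈ N, (256 ^ d * ε⁻¹ ^ d) := Finset.sum_le_sum fun u _ => hdeg u
        _ = _ := by simp
    have h4 : (N.card : ℝ) ≤ T.card := by exact_mod_cast Finset.card_le_card hNT
    have h5 : (1 : ℝ) ≤ ε⁻¹ ^ d := one_le_pow₀ ((one_le_inv₀ hε).2 hε1.le)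
    have h6 : (N.card : ℝ) * (256 ^ d * ε⁻¹ ^ d) ≤ T.card * (256 ^ d * ε⁻¹ ^ d) :=
      mul_le_mul_of_nonneg_right h4 (by positivity)
    have h7 : (T.card : ℝ) * 1 ≤ T.card * ε⁻¹ ^ d :=
      mul_le_mul_of_nonneg_left h5 (by positivity)
    linarith
  · intro x hx y hy hxy hlo hhi
    obtain ⟨hx1, hx2⟩ := hf x hx
    obtain ⟨hy1, hy2⟩ := hf y hy
    have hεℓ : ε * ℓ ≤ ℓ := by nlinarith
    have t1 : dist (f x) (f y) ≤ dist x y + 2 * (ε * ℓ / 32) := by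
      have a := dist_triangle4 (f x) x y (f y)
      rw [dist_comm (f x) x] at a
      linarith
    have e1 := hmem x (f x) (Finset.mem_union_left _ (Finset.mem_image.2 ⟨x, hx, rfl⟩))
    have e3 := hmem (f y) y (Finset.mem_union_left _ (Finset.mem_image.2 ⟨y, hy, Sym2.eq_swap⟩))
    have e2 := hmem (f x) (f y) (Finset.mem_union_right _ (Finset.mem_biUnion.2 ⟨f x, hx1,
      Finset.mem_image.2 ⟨f y, Finset.mem_filter.2 ⟨hy1, by rw [dist_comm]; linarith⟩, rfl⟩⟩))
    have s1 := pathDist_step _ x (f x) y e1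
    have s2 := pathDist_step _ (f x) (f y) y e2
    have s3 := pathDist_step _ (f y) y y e3
    rw [pathDist_refl_le, add_zero] at s3
    refine s1.trans ((add_le_add le_rfl (s2.trans (add_le_add le_rfl s3))).trans ?_)
    rw [← ENNReal.ofReal_add dist_nonneg dist_nonneg,
      ← ENNReal.ofReal_add dist_nonneg (by positivity)]
    apply ENNReal.ofReal_le_ofReal
    rw [dist_comm (f y) y]
    nlinarith
end
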